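/- For every positive integer k, M(1,1,...,1) with k ones equals ⌊k²/4⌋. That is, over all acyclic directed graphs with k distinct sources S_1,...,S_k and k distinct sinks R_1,...,R_k in which the min-cut from each S_i to R_i is 1, the largest possible value of the minimum number of pairwise mergings among k single paths β_i from S_i to R_i (minimized over all choices of the paths) equals ⌊k²/4⌋. -/

import Mathlib

/-- A finite directed multigraph. -/
structure MultiDigraph where
  V : Type
  E : Type
  fintV : Fintype V
  fintE : Fintype E
  src : E → V
  dst : E → V

namespace MultiDigraph

/-- `p` is a (nonempty) directed path from `u` to `v`, given as its list of edges. -/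
def IsPathFrom (G : MultiDigraph) (u v : G.V) (p : List G.E) : Prop :=
  p ≠ [] ∧ List.Chain' (fun e f => G.dst e = G.src f) p ∧
    (∀ e ∈ p.head?, G.src e = u) ∧ ∀ e ∈ p.getLast?, G.dst e = v

/-- `G` is acyclic: there is no (nonempty) directed path from a vertex to itself. -/
def Acyclic (G : MultiDigraph) : Prop :=
  ∀ (v : G.V) (p : List G.E), ¬ G.IsPathFrom v v p

/-- `α` is a family of `c` pairwise edge-disjoint directed paths from `u` to `v`. -/
def MengerSystem (G : MultiDigraph) (u v : G.V) (c : ℕ) (α : Fin c → List G.E) : Prop :=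
  (∀ i, G.IsPathFrom u v (α i)) ∧ ∀ i j, i ≠ j → ∀ e, e ∈ α i → e ∉ α j

/-- The min-cut between `u` and `v` equals `c`: by Menger's theorem, this means the
maximum number of pairwise edge-disjoint directed paths from `u` to `v` is exactly `c`. -/
def MinCut (G : MultiDigraph) (u v : G.V) (c : ℕ) : Prop :=
  (∃ α : Fin c → List G.E, G.MengerSystem u v c α) ∧
    ¬∃ α : Fin (c + 1) → List G.E, G.MengerSystem u v (c + 1) α

/-- Edge `e` is the starting edge of a merging among paths from (at least) two different
groups: `e` lies on a path of group `i` and on a path of group `j ≠ i`, and there are two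
distinct edges immediately ahead of `e` on these two paths.  Mergings are counted without
multiplicity: one merging per such edge `e`. -/
def MergingEdge (G : MultiDigraph) {l : ℕ} {c : Fin l → ℕ}
    (α : (i : Fin l) → Fin (c i) → List G.E) (e : G.E) : Prop :=
  ∃ i j : Fin l, i ≠ j ∧ ∃ (a : Fin (c i)) (b : Fin (c j)) (f g : G.E),
    f ≠ g ∧ [f, e] <:+: α i a ∧ [g, e] <:+: α j b

/-- The number of mergings among paths from different groups, `|G|_M(α₁,…,α_l)`. -/
noncomputable def mergingCount (G : MultiDigraph) {l : ℕ} {c : Fin l → ℕ}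
    (α : (i : Fin l) → Fin (c i) → List G.E) : ℕ :=
  Set.ncard {e : G.E | G.MergingEdge α e}

end MultiDigraph

open MultiDigraph

/-- `G` is a finite acyclic directed multigraph with designated sources `S i`, pairwise
distinct sinks `R i`, and min-cut `c i` between `S i` and `R i`. -/
def GoodConfig {l : ℕ} (G : MultiDigraph) (S R : Fin l → G.V) (c : Fin l → ℕ) : Prop :=
  G.Acyclic ∧ Function.Injective R ∧ ∀ i, G.MinCut (S i) (R i) (c i)

/-- `M(c₁,…,c_l) ≤ B`: in every acyclic graph with distinct sources, distinct sinks and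
the given min-cuts, some choice of Menger path systems yields at most `B` mergings. -/
def MAtMost {l : ℕ} (c : Fin l → ℕ) (B : ℕ) : Prop :=
  ∀ (G : MultiDigraph) (S R : Fin l → G.V), GoodConfig G S R c → Function.Injective S →
    ∃ α : (i : Fin l) → Fin (c i) → List G.E,
      (∀ i, G.MengerSystem (S i) (R i) (c i) (α i)) ∧ G.mergingCount α ≤ B

/-- `M(c₁,…,c_l) ≥ B`: some acyclic graph with distinct sources, distinct sinks and the
given min-cuts yields at least `B` mergings for every choice of Menger path systems. -/
def MAtLeast {l : ℕ} (c : Fin l → ℕ) (B : ℕ) : Prop :=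
  ∃ (G : MultiDigraph) (S R : Fin l → G.V), GoodConfig G S R c ∧ Function.Injective S ∧
    ∀ α : (i : Fin l) → Fin (c i) → List G.E,
      (∀ i, G.MengerSystem (S i) (R i) (c i) (α i)) → B ≤ G.mergingCount α

/-- `M(c₁,…,c_l) = B`: the largest possible value, over all acyclic graphs with distinct
sources and distinct sinks realizing the min-cuts `c`, of the minimum number of mergings
over all choices of Menger path systems, equals `B`. -/
def MEq {l : ℕ} (c : Fin l → ℕ) (B : ℕ) : Prop := MAtMost c B ∧ MAtLeast c B

/-- `M*(c₁,…,c_l) ≤ B`: as `MAtMost`, but with all sources identical. -/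
def MstarAtMost {l : ℕ} (c : Fin l → ℕ) (B : ℕ) : Prop :=
  ∀ (G : MultiDigraph) (S R : Fin l → G.V), GoodConfig G S R c → (∀ i j, S i = S j) →
    ∃ α : (i : Fin l) → Fin (c i) → List G.E,
      (∀ i, G.MengerSystem (S i) (R i) (c i) (α i)) ∧ G.mergingCount α ≤ B

/-- `M*(c₁,…,c_l) ≥ B`: as `MAtLeast`, but with all sources identical. -/
def MstarAtLeast {l : ℕ} (c : Fin l → ℕ) (B : ℕ) : Prop :=
  ∃ (G : MultiDigraph) (S R : Fin l → G.V), GoodConfig G S R c ∧ (∀ i j, S i = S j) ∧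
    ∀ α : (i : Fin l) → Fin (c i) → List G.E,
      (∀ i, G.MengerSystem (S i) (R i) (c i) (α i)) → B ≤ G.mergingCount α

/-- `M*(c₁,…,c_l) = B`: as `MEq`, but with all sources identical. -/
def MstarEq {l : ℕ} (c : Fin l → ℕ) (B : ℕ) : Prop := MstarAtMost c B ∧ MstarAtLeast c B


namespace MergeAux

open Relation

section Abstract

variable {E : Type} {k : ℕ} (St En : Fin k → E → Prop)

def Rl (T : Set (E × E)) (a b : E) : Prop := (a, b) ∈ T

def Reach (T : Set (E × E)) (i : Fin k) : Prop :=
  ∃ a b, St i a ∧ En i b ∧ ReflTransGen (Rl T) a b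

def DD (T : Set (E × E)) (i : Fin k) (x : E) : Prop :=
  ∃ a, St i a ∧ ReflTransGen (Rl T) a x

def Crit (T : Set (E × E)) (i : Fin k) (f e : E) : Prop := ¬ Reach St En (T \ {(f, e)}) i

theorem split {T : Set (E × E)} {a b : E} (f e : E) (h : ReflTransGen (Rl T) a b) :
    ReflTransGen (Rl (T \ {(f, e)})) a b ∨
      (ReflTransGen (Rl T) a f ∧ (f, e) ∈ T ∧ ReflTransGen (Rl T) e b) := by
  induction h with
  | refl => exact Or.inl .refl
  | @tail b c hab hbc ih =>
    rcases ih with ih | ⟨h1, h2, h3⟩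
    · by_cases hx : (b, c) = (f, e)
      · obtain ⟨rfl, rfl⟩ := Prod.mk.inj hx
        exact Or.inr ⟨hab, hbc, .refl⟩
      · exact Or.inl (ih.tail ⟨hbc, hx⟩)
    · exact Or.inr ⟨h1, h2, h3.tail hbc⟩

variable {St En} {T : Set (E × E)}

theorem crit_data (hT : ∀ i, Reach St En T i) {i : Fin k} {f e : E} (h : Crit St En T i f e) :
    ∃ a b, St i a ∧ En i b ∧ ReflTransGen (Rl T) a f ∧ (f, e) ∈ T ∧ ReflTransGen (Rl T) e b := by
  obtain ⟨a, b, ha, hb, hab⟩ := hT i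
  rcases split f e hab with h1 | ⟨h1, h2, h3⟩
  · exact absurd ⟨a, b, ha, hb, h1⟩ h
  · exact ⟨a, b, ha, hb, h1, h2, h3⟩

theorem DD.trans {i : Fin k} {x y : E} (h : DD St T i x) (hxy : ReflTransGen (Rl T) x y) :
    DD St T i y := by
  obtain ⟨a, ha, h⟩ := h
  exact ⟨a, ha, h.trans hxy⟩

theorem crit_DD (hT : ∀ i, Reach St En T i) {i : Fin k} {f e : E} (h : Crit St En T i f e) :
    DD St T i f := by
  obtain ⟨a, b, ha, hb, h1, h2, h3⟩ := crit_data hT h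
  exact ⟨a, ha, h1⟩

theorem crit_DD' (hT : ∀ i, Reach St En T i) {i : Fin k} {f e : E} (h : Crit St En T i f e) :
    DD St T i e := by
  obtain ⟨a, b, ha, hb, h1, h2, h3⟩ := crit_data hT h
  exact ⟨a, ha, h1.tail h2⟩

theorem key (hT : ∀ i, Reach St En T i) (hac : ∀ x, ¬ TransGen (Rl T) x x)
    {i : Fin k} {f g e : E} (h : Crit St En T i f e)
    (hg : (g, e) ∈ T) (hfg : f ≠ g) : ¬ DD St T i g := by
  rintro ⟨a', ha', hag⟩
  obtain ⟨a, b, ha, hb, h1, h2, h3⟩ := crit_data hT h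
  apply h
  refine ⟨a', b, ha', hb, ?_⟩
  have hge : ReflTransGen (Rl (T \ {(f, e)})) g e := by
    refine .single ⟨hg, ?_⟩
    intro hh
    exact hfg (Prod.mk.inj hh).1.symm
  rcases split f e hag with h4 | ⟨h4, h5, h6⟩
  · rcases split f e h3 with h7 | ⟨h7, h8, h9⟩
    · exact (h4.trans hge).trans h7
    · exact absurd (TransGen.tail' h7 h8) (hac e)
  · exact absurd (TransGen.tail' h6 hg) (hac e)

theorem comp (hT : ∀ i, Reach St En T i)
    {i : Fin k} {f e f' e' : E} (h : Crit St En T i f e) (h' : Crit St En T i f' e')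
    (hne : e ≠ e') : ReflTransGen (Rl T) e f' ∨ ReflTransGen (Rl T) e' f := by
  obtain ⟨a, b, ha, hb, h1, h2, h3⟩ := crit_data hT h
  rcases split f' e' h1 with h4 | ⟨h4, h5, h6⟩
  · rcases split f' e' h3 with h7 | ⟨h7, h8, h9⟩
    · refine absurd ⟨a, b, ha, hb, (h4.tail ⟨h2, ?_⟩).trans h7⟩ h'
      intro hh
      exact hne (Prod.mk.inj hh).2
    · exact Or.inl h7
  · exact Or.inr h6

/-- pair data at a merging edge -/
def PD (St En : Fin k → E → Prop) (T : Set (E × E)) (e : E) (i j : Fin k) : Prop :=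
  ∃ f g, f ≠ g ∧ Crit St En T i f e ∧ Crit St En T j g e

theorem PD.symm {e : E} {i j : Fin k} (h : PD St En T e i j) : PD St En T e j i := by
  obtain ⟨f, g, a, b, c⟩ := h
  exact ⟨g, f, a.symm, c, b⟩

theorem PD.mem (hT : ∀ i, Reach St En T i) {i : Fin k} {f e : E} (h : Crit St En T i f e) :
    (f, e) ∈ T := by
  obtain ⟨a, b, ha, hb, h1, h2, h3⟩ := crit_data hT h
  exact h2

theorem PD.inj (hT : ∀ i, Reach St En T i) (hac : ∀ x, ¬ TransGen (Rl T) x x)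
    {e e' : E} {i j : Fin k} (h : PD St En T e i j) (h' : PD St En T e' i j) : e = e' := by
  by_contra hne
  obtain ⟨f, g, a, b, c⟩ := h
  obtain ⟨f', g', a', b', c'⟩ := h'
  rcases comp hT c c' hne with h1 | h1
  · exact key hT hac b' (PD.mem hT c') a' ((crit_DD' hT b).trans h1)
  · exact key hT hac b (PD.mem hT c) a ((crit_DD' hT b').trans h1)

theorem PD.lt_or (hT : ∀ i, Reach St En T i) 
    {e e' : E} {i j l : Fin k} (h : PD St En T e i j) (h' : PD St En T e' i l) (hne : e ≠ e') :
    TransGen (Rl T) e e' ∨ TransGen (Rl T) e' e := by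
  obtain ⟨f, g, a, b, c⟩ := h
  obtain ⟨f', g', a', b', c'⟩ := h'
  rcases comp hT b b' hne with h1 | h1
  · exact Or.inl (TransGen.tail' h1 (PD.mem hT b'))
  · exact Or.inr (TransGen.tail' h1 (PD.mem hT b))

theorem PD.tri (hT : ∀ i, Reach St En T i) (hac : ∀ x, ¬ TransGen (Rl T) x x)
    {e1 e2 e3 : E} {a b c : Fin k} (h1 : PD St En T e1 a c) (h2 : PD St En T e2 a b)
    (h3 : PD St En T e3 b c) (h12 : TransGen (Rl T) e1 e2) (h23 : TransGen (Rl T) e2 e3) :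
    False := by
  obtain ⟨f1, g1, n1, p1, q1⟩ := h1
  obtain ⟨f2, g2, n2, p2, q2⟩ := h2
  obtain ⟨f3, g3, n3, p3, q3⟩ := h3
  have hne : e2 ≠ e3 := by
    rintro rfl
    exact hac _ h23
  rcases comp hT q2 p3 hne with h | h
  · exact key hT hac q3 (PD.mem hT p3) n3.symm
      (((crit_DD' hT q1).trans h12.to_reflTransGen).trans h)
  · exact hac _ (h23.trans (TransGen.tail' h (PD.mem hT q2)))

theorem PD.tri' (hT : ∀ i, Reach St En T i) (hac : ∀ x, ¬ TransGen (Rl T) x x)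
    {e1 e2 e3 : E} {a b c : Fin k} (h1 : PD St En T e1 a c) (h2 : PD St En T e2 a b)
    (h3 : PD St En T e3 b c) (n12 : e1 ≠ e2) (n23 : e2 ≠ e3) (n13 : e1 ≠ e3) :
    False := by
  rcases h1.lt_or hT h2 n12 with h12 | h12 <;> rcases h2.symm.lt_or hT h3 n23 with h23 | h23 <;>
    rcases h1.symm.lt_or hT h3.symm n13 with h13 | h13
  · exact h1.tri hT hac h2 h3 h12 h23
  · exact hac _ ((h12.trans h23).trans h13)
  · exact h1.symm.tri hT hac h3.symm h2.symm h13 h23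
  · exact h3.symm.tri hT hac h1.symm h2 h13 h12
  · exact h2.tri hT hac h1 h3.symm h12 h13
  · exact h2.symm.tri hT hac h3 h1.symm h23 h13
  · exact hac _ ((h13.trans h23).trans h12)
  · exact h3.tri hT hac h2.symm h1 h23 h12

theorem count [Finite E] (hT : ∀ i, Reach St En T i) (hac : ∀ x, ¬ TransGen (Rl T) x x)
    (hmin : ∀ f e, (f, e) ∈ T → ∃ i, Crit St En T i f e) :
    Set.ncard {e | ∃ f g, f ≠ g ∧ (f, e) ∈ T ∧ (g, e) ∈ T} ≤ k ^ 2 / 4 := by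
  classical
  set A := {e | ∃ f g, f ≠ g ∧ (f, e) ∈ T ∧ (g, e) ∈ T} with hA
  have hlab : ∀ e : A, ∃ i j, i ≠ j ∧ PD St En T e i j := by
    rintro ⟨e, f, g, hfg, hf, hg⟩
    obtain ⟨i, hi⟩ := hmin f e hf
    obtain ⟨j, hj⟩ := hmin g e hg
    refine ⟨i, j, ?_, f, g, hfg, hi, hj⟩
    rintro rfl
    exact key hT hac hi hg hfg (crit_DD hT hj)
  choose p q hpq hPD using hlab
  let lab : A → Sym2 (Fin k) := fun e => s(p e, q e)
  have hl : ∀ e i j, lab e = s(i, j) → PD St En T e i j := by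
    intro e i j h
    rcases Sym2.eq_iff.1 h with ⟨h1, h2⟩ | ⟨h1, h2⟩
    · rw [← h1, ← h2]; exact hPD e
    · rw [← h1, ← h2]; exact (hPD e).symm
  have hinj : Function.Injective lab := by
    intro e e' h
    exact Subtype.ext ((hPD e).inj hT hac (hl e' _ _ h.symm))
  let H : SimpleGraph (Fin k) := SimpleGraph.fromEdgeSet (Set.range lab)
  have hH : H.edgeSet = Set.range lab := by
    rw [SimpleGraph.edgeSet_fromEdgeSet, sdiff_eq_left, Set.disjoint_left]
    rintro _ ⟨e, rfl⟩ h
    exact hpq e (by simpa [lab] using h)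
  have hfree : H.CliqueFree 3 := by
    intro s hs
    rw [SimpleGraph.is3Clique_iff] at hs
    obtain ⟨a, b, c, hab, hac', hbc, -⟩ := hs
    rw [SimpleGraph.fromEdgeSet_adj] at hab hac' hbc
    obtain ⟨⟨e2, h2⟩, nab⟩ := hab
    obtain ⟨⟨e1, h1⟩, nac⟩ := hac'
    obtain ⟨⟨e3, h3⟩, nbc⟩ := hbc
    refine (hl _ _ _ h1).tri' hT hac (hl _ _ _ h2) (hl _ _ _ h3) ?_ ?_ ?_ <;> intro h <;>
      replace h := congrArg lab (Subtype.ext h) <;> simp only [h1, h2, h3, Sym2.eq_iff] at h <;> grind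
  have hc := hfree.card_edgeFinset_le
  have h1 : A.ncard = H.edgeFinset.card := by
    rw [← Set.ncard_coe_finset, SimpleGraph.coe_edgeFinset, hH, ← Set.image_univ,
      Set.ncard_image_of_injective _ hinj, Set.ncard_univ, Nat.card_coe_set_eq]
  rw [h1]
  refine le_trans (le_of_eq (by congr; exact Subsingleton.elim _ _)) (hc.trans ?_)
  simp only [Fintype.card_fin]
  rcases Nat.mod_two_eq_zero_or_one k with h | h <;> rw [h] <;> simp
  omega

end Abstract

theorem rtg_path (G : MultiDigraph) {T : Set (G.E × G.E)} (hT : ∀ a b, (a, b) ∈ T → G.dst a = G.src b)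
    {a b : G.E} (h : ReflTransGen (Rl T) a b) :
    ∃ p, G.IsPathFrom (G.src a) (G.dst b) p ∧ List.IsChain (Rl T) p := by
  obtain ⟨l, hl, hc, h1, h2⟩ := List.exists_isChain_ne_nil_of_relationReflTransGen h
  refine ⟨l, ⟨hl, ?_, ?_, ?_⟩, hc⟩
  · exact hc.imp hT
  · intro e he
    rw [List.head?_eq_some_head hl] at he
    simp at he
    rw [← he, h1]
  · intro e he
    rw [List.getLast?_eq_some_getLast hl] at he
    simp at he
    rw [← he, h2]

theorem path_rtg (G : MultiDigraph) {u v : G.V} {p : List G.E} (h : G.IsPathFrom u v p) :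
    ∃ a b, G.src a = u ∧ G.dst b = v ∧ 
      ReflTransGen (Rl {x : G.E × G.E | G.dst x.1 = G.src x.2}) a b := by
  obtain ⟨hl, hc, h1, h2⟩ := h
  refine ⟨p.head hl, p.getLast hl, h1 _ ?_, h2 _ ?_, ?_⟩
  · rw [List.head?_eq_some_head hl]; simp
  · rw [List.getLast?_eq_some_getLast hl]; simp
  · exact List.relationReflTransGen_of_exists_isChain p hc hl

theorem upper (k : ℕ) : MAtMost (fun _ : Fin k => 1) (k ^ 2 / 4) := by
  classical
  intro G S R hG hS
  obtain ⟨hac, hR, hcut⟩ := hG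
  have := G.fintE
  let St : Fin k → G.E → Prop := fun i e => G.src e = S i
  let En : Fin k → G.E → Prop := fun i e => G.dst e = R i
  let P : Set (G.E × G.E) → Prop := fun T =>
    (∀ a b, (a, b) ∈ T → G.dst a = G.src b) ∧ ∀ i, Reach St En T i
  have hex : ∃ T, P T := by
    refine ⟨{x : G.E × G.E | G.dst x.1 = G.src x.2}, fun a b h => h, fun i => ?_⟩
    obtain ⟨α, hα, -⟩ := (hcut i).1
    obtain ⟨a, b, h1, h2, h3⟩ := path_rtg G (hα 0)
    exact ⟨a, b, h1, h2, h3⟩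
  obtain ⟨T, hTm⟩ := Set.Finite.exists_minimal (Set.toFinite {T | P T}) hex
  obtain ⟨⟨hadj, hT⟩, hmin⟩ := hTm
  have hcrit : ∀ f e, (f, e) ∈ T → ∃ i, Crit St En T i f e := by
    intro f e hfe
    by_contra hcon
    simp only [Crit, not_exists, not_not] at hcon
    have := hmin (y := T \ {(f, e)}) ⟨fun a b h => hadj a b h.1, hcon⟩ Set.sdiff_subset
    exact (this hfe).2 rfl
  have hacT : ∀ x, ¬ TransGen (Rl T) x x := by
    intro x hx
    obtain ⟨y, hxy, hyx⟩ := TransGen.tail'_iff.1 hx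
    obtain ⟨p, hp, -⟩ := rtg_path G hadj hxy
    exact hac _ p (hadj _ _ hyx ▸ hp)
  have hp : ∀ i, ∃ p, G.IsPathFrom (S i) (R i) p ∧ List.IsChain (Rl T) p := by
    intro i
    obtain ⟨a, b, ha, hb, hab⟩ := hT i
    obtain ⟨p, hp, hc⟩ := rtg_path G hadj hab
    exact ⟨p, by rw [← ha, ← hb]; exact hp, hc⟩
  choose p hp hc using hp
  refine ⟨fun i _ => p i, fun i => ⟨fun _ => hp i, fun a b hab => absurd (Subsingleton.elim a b) hab⟩, ?_⟩
  refine le_trans (Set.ncard_le_ncard ?_ (Set.toFinite _)) (count hT hacT hcrit)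
  rintro e ⟨i, j, hij, a, b, f, g, hfg, hf, hg⟩
  have h1 := (hc i).infix hf
  have h2 := (hc j).infix hg
  simp only [List.isChain_cons_cons] at h1 h2
  exact ⟨f, g, hfg, h1.1, h2.1⟩

end MergeAux

namespace MergeAux

open Relation

/-- the grid graph -/
def Grid (n m : ℕ) : MultiDigraph where
  V := (Fin (n + 1) × Fin (m + 1)) ⊕ (Fin (n + 1) × Fin (m + 1))
  E := (Fin n × Fin (m + 1)) ⊕ ((Fin (n + 1) × Fin m) ⊕ (Fin n × Fin m))
  fintV := inferInstance
  fintE := inferInstance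
  src := fun e => match e with
    | .inl (i, j) => .inr (i.succ, j)
    | .inr (.inl (i, j)) => .inr (i, j.succ)
    | .inr (.inr (i, j)) => .inl (i.castSucc, j.castSucc)
  dst := fun e => match e with
    | .inl (i, j) => .inl (i.castSucc, j)
    | .inr (.inl (i, j)) => .inl (i, j.castSucc)
    | .inr (.inr (i, j)) => .inr (i.succ, j.succ)

variable {n m : ℕ}

def rho : (Grid n m).V → ℕ
  | .inl (i, _) => i.val + 1
  | .inr (i, _) => i.val

def gam : (Grid n m).V → ℕ
  | .inl (_, j) => j.val + 1
  | .inr (_, j) => j.val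

def bl : (Grid n m).V → ℕ
  | .inl _ => 1
  | .inr _ => 0

def rt (i : Fin n) (j : Fin (m + 1)) : (Grid n m).E := Sum.inl (i, j)
def dn (i : Fin (n + 1)) (j : Fin m) : (Grid n m).E := Sum.inr (Sum.inl (i, j))
def sh (i : Fin n) (j : Fin m) : (Grid n m).E := Sum.inr (Sum.inr (i, j))

theorem edge_cases (e : (Grid n m).E) :
    (∃ i j, e = rt i j) ∨ (∃ i j, e = dn i j) ∨ (∃ i j, e = sh i j) := by
  rcases e with ⟨i, j⟩ | ⟨i, j⟩ | ⟨i, j⟩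
  · exact Or.inl ⟨i, j, rfl⟩
  · exact Or.inr (Or.inl ⟨i, j, rfl⟩)
  · exact Or.inr (Or.inr ⟨i, j, rfl⟩)

theorem rt_src (i : Fin n) (j : Fin (m + 1)) : (Grid n m).src (rt i j) = Sum.inr (i.succ, j) := rfl
theorem rt_dst (i : Fin n) (j : Fin (m + 1)) :
    (Grid n m).dst (rt i j) = Sum.inl (i.castSucc, j) := rfl
theorem dn_src (i : Fin (n + 1)) (j : Fin m) : (Grid n m).src (dn i j) = Sum.inr (i, j.succ) := rfl
theorem dn_dst (i : Fin (n + 1)) (j : Fin m) :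
    (Grid n m).dst (dn i j) = Sum.inl (i, j.castSucc) := rfl
theorem sh_src (i : Fin n) (j : Fin m) :
    (Grid n m).src (sh i j) = Sum.inl (i.castSucc, j.castSucc) := rfl
theorem sh_dst (i : Fin n) (j : Fin m) : (Grid n m).dst (sh i j) = Sum.inr (i.succ, j.succ) := rfl

theorem rho_inl (i : Fin (n + 1)) (j : Fin (m + 1)) :
    rho (n := n) (m := m) (Sum.inl (i, j)) = i.val + 1 := rfl
theorem rho_inr (i : Fin (n + 1)) (j : Fin (m + 1)) :
    rho (n := n) (m := m) (Sum.inr (i, j)) = i.val := rfl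
theorem gam_inl (i : Fin (n + 1)) (j : Fin (m + 1)) :
    gam (n := n) (m := m) (Sum.inl (i, j)) = j.val + 1 := rfl
theorem gam_inr (i : Fin (n + 1)) (j : Fin (m + 1)) :
    gam (n := n) (m := m) (Sum.inr (i, j)) = j.val := rfl
theorem bl_inl (x) : bl (n := n) (m := m) (Sum.inl x) = 1 := rfl
theorem bl_inr (x) : bl (n := n) (m := m) (Sum.inr x) = 0 := rfl

/-- rank, increasing by exactly one along each edge (two rho + two gam minus bl) -/
def rk (v : (Grid n m).V) : ℤ := 2 * rho v + 2 * gam v - bl v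

theorem rk_edge (e : (Grid n m).E) : rk ((Grid n m).dst e) = rk ((Grid n m).src e) + 1 := by
  rcases edge_cases e with ⟨i, j, rfl⟩ | ⟨i, j, rfl⟩ | ⟨i, j, rfl⟩ <;>
    simp [rk, rt_src, rt_dst, dn_src, dn_dst, sh_src, sh_dst, rho_inl, rho_inr, gam_inl, gam_inr,
      bl_inl, bl_inr] <;> ring

theorem rho_edge (e : (Grid n m).E) : rho ((Grid n m).src e) ≤ rho ((Grid n m).dst e) := by
  rcases edge_cases e with ⟨i, j, rfl⟩ | ⟨i, j, rfl⟩ | ⟨i, j, rfl⟩ <;>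
    simp [rt_src, rt_dst, dn_src, dn_dst, sh_src, sh_dst, rho_inl, rho_inr]

theorem gam_edge (e : (Grid n m).E) : gam ((Grid n m).src e) ≤ gam ((Grid n m).dst e) := by
  rcases edge_cases e with ⟨i, j, rfl⟩ | ⟨i, j, rfl⟩ | ⟨i, j, rfl⟩ <;>
    simp [rt_src, rt_dst, dn_src, dn_dst, sh_src, sh_dst, gam_inl, gam_inr]

theorem path_cons (G : MultiDigraph) {u v : G.V} {e : G.E} {p : List G.E}
    (h : G.IsPathFrom u v (e :: p)) :
    G.src e = u ∧ ((p = [] ∧ G.dst e = v) ∨ G.IsPathFrom (G.dst e) v p) := by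
  obtain ⟨-, hc, h1, h2⟩ := h
  change List.IsChain _ _ at hc
  refine ⟨h1 e (by simp), ?_⟩
  cases p with
  | nil => exact Or.inl ⟨rfl, h2 e (by simp)⟩
  | cons f q =>
    rw [List.isChain_cons_cons] at hc
    refine Or.inr ⟨by simp, hc.2, ?_, ?_⟩
    · intro e' he'
      simp at he'
      rw [← he', hc.1]
    · intro e' he'
      exact h2 e' (by simpa using he')

/-- Along a path, the potentials are monotone, and all ranks are visited. -/
theorem path_visit {u v : (Grid n m).V} {p : List (Grid n m).E} (h : (Grid n m).IsPathFrom u v p) :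
    rk u + p.length = rk v ∧
    ∀ t (ht : t < p.length), rk ((Grid n m).src p[t]) = rk u + t ∧
      rho u ≤ rho ((Grid n m).src p[t]) ∧ rho ((Grid n m).dst p[t]) ≤ rho v ∧
      gam u ≤ gam ((Grid n m).src p[t]) ∧ gam ((Grid n m).dst p[t]) ≤ gam v := by
  induction p generalizing u with
  | nil => exact absurd rfl h.1
  | cons e p ih =>
    obtain ⟨hs, h⟩ := path_cons _ h
    have e1 := rk_edge e
    have e2 := rho_edge e
    have e3 := gam_edge e
    rw [hs] at e1 e2 e3
    rcases h with ⟨rfl, rfl⟩ | h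
    · refine ⟨by simp [e1], ?_⟩
      intro t ht
      simp at ht
      subst ht
      simp [hs]
    · obtain ⟨h1, h2⟩ := ih h
      refine ⟨by rw [← h1, e1]; push_cast [List.length_cons]; ring, ?_⟩
      intro t ht
      cases t with
      | zero =>
        have hp : 0 < p.length := List.length_pos_iff.2 h.1
        obtain ⟨-, b, c, d, f⟩ := h2 0 hp
        have := rho_edge p[0]
        have := gam_edge p[0]
        simp only [List.getElem_cons_zero, hs]
        refine ⟨by simp, le_rfl, by omega, le_rfl, by omega⟩
      | succ t =>
        obtain ⟨a, b, c, d, f⟩ := h2 t (by simpa using ht)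
        simp only [List.getElem_cons_succ]
        refine ⟨by rw [a, e1]; push_cast; ring, by omega, c, by omega, f⟩

theorem infix_pair {α : Type} {p : List α} {t : ℕ} (h : t + 1 < p.length) :
    [p[t], p[t+1]] <:+: p := by
  exact (List.isChain_isInfix p).getElem t h

theorem grid_acyclic : (Grid n m).Acyclic := by
  intro v p h
  have h1 := (path_visit h).1
  have : 0 < p.length := List.length_pos_iff.2 h.1
  omega

def rS (i : Fin n) : (Grid n m).V := Sum.inr (i.succ, 0)
def rR (i : Fin n) : (Grid n m).V := Sum.inl (i.castSucc, Fin.last m)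
def cS (j : Fin m) : (Grid n m).V := Sum.inr (0, j.succ)
def cR (j : Fin m) : (Grid n m).V := Sum.inl (Fin.last n, j.castSucc)

theorem row_path {i : Fin n} {p : List (Grid n m).E}
    (h : (Grid n m).IsPathFrom (rS i) (rR i) p) :
    p.length = 2 * m + 1 ∧ 
    (∀ (j : Fin (m + 1)) (hj : 2 * j.val < p.length), p[2 * j.val] = rt i j) ∧
    (∀ (j : Fin m) (hj : 2 * j.val + 1 < p.length), p[2 * j.val + 1] = sh i j) := by
  obtain ⟨h1, h2⟩ := path_visit h
  simp only [rS, rR, rk, rho_inl, rho_inr, gam_inl, gam_inr, bl_inl, bl_inr] at h1 h2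
  simp at h1 h2
  refine ⟨by omega, ?_, ?_⟩
  · intro j hj
    obtain ⟨a, b, c, -⟩ := h2 _ hj
    rcases edge_cases p[2 * j.val] with ⟨i', j', h⟩ | ⟨i', j', h⟩ | ⟨i', j', h⟩ <;> rw [h] at a b c ⊢ <;>
      simp only [rt_src, rt_dst, dn_src, dn_dst, sh_src, sh_dst, rho_inl, rho_inr, gam_inl, gam_inr,
      bl_inl, bl_inr] at a b c <;> simp at a b c
    · have : i' = i := by ext; omega
      have : j' = j := by ext; omega
      simp [*]
    · omega
    · omega
  · intro j hj
    obtain ⟨a, b, c, -⟩ := h2 _ hj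
    rcases edge_cases p[2 * j.val + 1] with ⟨i', j', h⟩ | ⟨i', j', h⟩ | ⟨i', j', h⟩ <;> rw [h] at a b c ⊢ <;>
      simp only [rt_src, rt_dst, dn_src, dn_dst, sh_src, sh_dst, rho_inl, rho_inr, gam_inl, gam_inr,
      bl_inl, bl_inr] at a b c <;> simp at a b c
    · omega
    · omega
    · have : i' = i := by ext; omega
      have : j' = j := by ext; omega
      simp [*]

theorem col_path {j : Fin m} {p : List (Grid n m).E}
    (h : (Grid n m).IsPathFrom (cS j) (cR j) p) :
    p.length = 2 * n + 1 ∧ 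
    (∀ (i : Fin (n + 1)) (hj : 2 * i.val < p.length), p[2 * i.val] = dn i j) ∧
    (∀ (i : Fin n) (hj : 2 * i.val + 1 < p.length), p[2 * i.val + 1] = sh i j) := by
  obtain ⟨h1, h2⟩ := path_visit h
  simp only [cS, cR, rk, rho_inl, rho_inr, gam_inl, gam_inr, bl_inl, bl_inr] at h1 h2
  simp at h1 h2
  refine ⟨by omega, ?_, ?_⟩
  · intro i hj
    obtain ⟨a, -, b, c⟩ := h2 _ hj
    rcases edge_cases p[2 * i.val] with ⟨i', j', h⟩ | ⟨i', j', h⟩ | ⟨i', j', h⟩ <;> rw [h] at a b c ⊢ <;>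
      simp only [rt_src, rt_dst, dn_src, dn_dst, sh_src, sh_dst, rho_inl, rho_inr, gam_inl, gam_inr,
      bl_inl, bl_inr] at a b c <;> simp at a b c
    · omega
    · have : i' = i := by ext; omega
      have : j' = j := by ext; omega
      simp [*]
    · omega
  · intro i hj
    obtain ⟨a, -, b, c⟩ := h2 _ hj
    rcases edge_cases p[2 * i.val + 1] with ⟨i', j', h⟩ | ⟨i', j', h⟩ | ⟨i', j', h⟩ <;> rw [h] at a b c ⊢ <;>
      simp only [rt_src, rt_dst, dn_src, dn_dst, sh_src, sh_dst, rho_inl, rho_inr, gam_inl, gam_inr,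
      bl_inl, bl_inr] at a b c <;> simp at a b c
    · omega
    · omega
    · have : i' = i := by ext; omega
      have : j' = j := by ext; omega
      simp [*]

theorem row_exists (i : Fin n) : ∃ p, (Grid n m).IsPathFrom (rS i) (rR i) p := by
  have key : ∀ j : Fin (m + 1), ReflTransGen
      (Rl {x : (Grid n m).E × (Grid n m).E | (Grid n m).dst x.1 = (Grid n m).src x.2})
      (rt i 0) (rt i j) := by
    intro j
    induction j using Fin.induction with
    | zero => exact .refl
    | succ j ih => exact (ih.tail (b := rt i j.castSucc) (c := sh i j) rfl).tail rfl
  obtain ⟨p, hp, -⟩ := rtg_path (Grid n m) (fun a b h => h) (key (Fin.last m))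
  exact ⟨p, hp⟩

theorem col_exists (j : Fin m) : ∃ p, (Grid n m).IsPathFrom (cS j) (cR j) p := by
  have key : ∀ i : Fin (n + 1), ReflTransGen
      (Rl {x : (Grid n m).E × (Grid n m).E | (Grid n m).dst x.1 = (Grid n m).src x.2})
      (dn 0 j) (dn i j) := by
    intro i
    induction i using Fin.induction with
    | zero => exact .refl
    | succ i ih => exact (ih.tail (b := dn i.castSucc j) (c := sh i j) rfl).tail rfl
  obtain ⟨p, hp, -⟩ := rtg_path (Grid n m) (fun a b h => h) (key (Fin.last n))
  exact ⟨p, hp⟩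

theorem cut_one (G : MultiDigraph) {u v : G.V} (e : G.E) (hex : ∃ p, G.IsPathFrom u v p)
    (h : ∀ p, G.IsPathFrom u v p → e ∈ p) : G.MinCut u v 1 := by
  obtain ⟨p, hp⟩ := hex
  refine ⟨⟨fun _ => p, fun _ => hp, fun a b hab => absurd (Subsingleton.elim a b) hab⟩, ?_⟩
  rintro ⟨α, h1, h2⟩
  exact h2 0 1 (by simp) e (h _ (h1 0)) (h _ (h1 1))

theorem row_cut (i : Fin n) : (Grid n m).MinCut (rS i) (rR i) 1 := by
  refine cut_one _ (rt i 0) (row_exists i) ?_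
  intro p hp
  obtain ⟨h1, h2, -⟩ := row_path hp
  rw [← h2 0 (by simp; omega)]
  exact List.getElem_mem _

theorem col_cut (j : Fin m) : (Grid n m).MinCut (cS j) (cR j) 1 := by
  refine cut_one _ (dn 0 j) (col_exists j) ?_
  intro p hp
  obtain ⟨h1, h2, -⟩ := col_path hp
  rw [← h2 0 (by simp; omega)]
  exact List.getElem_mem _

theorem lower_aux (n m : ℕ) : MAtLeast (fun _ : Fin (n + m) => 1) (n * m) := by
  refine ⟨Grid n m, Fin.addCases rS cS, Fin.addCases rR cR, ⟨grid_acyclic, ?_, ?_⟩, ?_, ?_⟩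
  · intro a b h
    have h1 := congrArg rho h
    have h2 := congrArg gam h
    clear h
    induction a using Fin.addCases <;> induction b using Fin.addCases <;>
      simp only [Fin.addCases_left, Fin.addCases_right, rR, cR, rho_inl, gam_inl,
        Fin.ext_iff] at h1 h2 ⊢ <;> simp at h1 h2 ⊢ <;> omega
  · intro a
    induction a using Fin.addCases with
    | left i => simpa only [Fin.addCases_left] using row_cut i
    | right i => simpa only [Fin.addCases_right] using col_cut i
  · intro a b h
    have h1 := congrArg rho h
    have h2 := congrArg gam h
    clear h
    induction a using Fin.addCases <;> induction b using Fin.addCases <;>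
      simp only [Fin.addCases_left, Fin.addCases_right, rS, cS, rho_inr, gam_inr,
        Fin.ext_iff] at h1 h2 ⊢ <;> simp at h1 h2 ⊢ <;> omega
  · intro α hα
    have hinj : Function.Injective (fun x : Fin n × Fin m => sh x.1 x.2) := by
      rintro ⟨a, b⟩ ⟨c, d⟩ h
      exact Sum.inr_injective (Sum.inr_injective h)
    have := (Grid n m).fintE
    have hcard : (Set.range (fun x : Fin n × Fin m => sh x.1 x.2)).ncard = n * m := by
      rw [← Set.image_univ, Set.ncard_image_of_injective _ hinj, Set.ncard_univ]
      simp
    rw [← hcard]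
    refine Set.ncard_le_ncard ?_ (Set.toFinite _)
    rintro _ ⟨⟨i, j⟩, rfl⟩
    have hr := (hα (Fin.castAdd m i)).1 0
    have hc := (hα (Fin.natAdd n j)).1 0
    simp only [Fin.addCases_left, Fin.addCases_right] at hr hc
    obtain ⟨r1, r2, r3⟩ := row_path hr
    obtain ⟨c1, c2, c3⟩ := col_path hc
    refine ⟨Fin.castAdd m i, Fin.natAdd n j, ?_, 0, 0, rt i j.castSucc, dn i.castSucc j, ?_, ?_, ?_⟩
    · simp only [ne_eq, Fin.ext_iff, Fin.val_castAdd, Fin.val_natAdd]; omega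
    · exact Sum.inl_ne_inr
    · have hlt : 2 * j.val + 1 < (α (Fin.castAdd m i) 0).length := by rw [r1]; omega
      have := infix_pair hlt
      have h2 := r2 j.castSucc (Nat.lt_of_succ_lt hlt)
      simp only [Fin.val_castSucc] at h2
      rw [r3 j hlt, h2] at this
      exact this
    · have hlt : 2 * i.val + 1 < (α (Fin.natAdd n j) 0).length := by rw [c1]; omega
      have := infix_pair hlt
      have h2 := c2 i.castSucc (Nat.lt_of_succ_lt hlt)
      simp only [Fin.val_castSucc] at h2
      rw [c3 i hlt, h2] at this
      exact this

theorem lower (k : ℕ) : MAtLeast (fun _ : Fin k => 1) (k ^ 2 / 4) := by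
  obtain ⟨n, m, h1, h2⟩ : ∃ n m, k = n + m ∧ k ^ 2 / 4 = n * m := by
    rcases Nat.even_or_odd' k with ⟨c, rfl | rfl⟩
    · exact ⟨c, c, by omega, by rw [show (2 * c) ^ 2 = 4 * (c * c) by ring]; omega⟩
    · refine ⟨c + 1, c, by omega, ?_⟩
      rw [show (2 * c + 1) ^ 2 = 4 * ((c + 1) * c) + 1 by ring]; omega
  rw [h2]
  subst h1
  exact lower_aux n m

end MergeAux

/-- For every positive integer `k`, `M(1, 1, …, 1)` (with `k` ones)
equals `⌊k² / 4⌋`. -/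
theorem M_all_ones (k : ℕ) (hk : 0 < k) :
    MEq (fun _ : Fin k => 1) (k ^ 2 / 4) := by
  exact ⟨MergeAux.upper k, MergeAux.lower k⟩
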